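/- Let g be a reductive complex Lie algebra with finite-order automorphism θ giving g = ⊕_k g_k, and let x = x_s + x_n ∈ g_1 be the Jordan decomposition of an element of g_1 (x_s semisimple, x_n nilpotent, [x_s, x_n] = 0). Write m = Z_g(x_s), Z_{x,1} = Z(m) ∩ g_1 and h_{x,1} = [m, m] ∩ g_1. Then there is a direct sum decomposition g_1 = [g_0, x_s] ⊕ Z_{x,1} ⊕ h_{x,1}, and [g_0, x_s] ≅ g_0 / Z_{g_0}(x_s) as vector spaces. Consequently, if moreover Z_{g_0}(x_s) = Z(g)_0 ⊕ ([m,m] ∩ g_0), then dim g_1 − dim g_0 = dim h_{x,1} − dim([m,m] ∩ g_0) + dim Z_{x,1} − dim Z(g)_0. -/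

import Mathlib

theorem Module.End.IsSemisimple.isCompl_ker_range {K V : Type*} [Field K] [AddCommGroup V]
    [Module K V] [FiniteDimensional K V] {f : Module.End K V} (hf : f.IsSemisimple) :
    IsCompl (LinearMap.ker f) (LinearMap.range f) := by
  obtain ⟨q, hq, hc⟩ := Module.End.isSemisimple_iff.mp hf (LinearMap.ker f) (by
    intro v hv
    simp_all)
  have hle : LinearMap.range f ≤ q := by
    rintro _ ⟨v, rfl⟩
    obtain ⟨a, ha, b, hb, rfl⟩ := Submodule.mem_sup.mp
      (hc.sup_eq_top ▸ Submodule.mem_top : v ∈ LinearMap.ker f ⊔ q)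
    rw [map_add, LinearMap.mem_ker.mp ha, zero_add]
    exact hq hb
  have hd := Submodule.finrank_add_eq_of_isCompl hc
  have hr := LinearMap.finrank_range_add_finrank_ker f
  rwa [Submodule.eq_of_le_of_finrank_le hle (by omega)]

theorem Module.End.isNilpotent_of_eigenspace_eq_bot {K V : Type*} [Field K] [IsAlgClosed K]
    [AddCommGroup V] [Module K V] [FiniteDimensional K V] {f : Module.End K V}
    (hf : ∀ μ : K, μ ≠ 0 → f.eigenspace μ = ⊥) : IsNilpotent f := by
  have htop : f.maxGenEigenspace 0 = ⊤ := by
    rw [← Module.End.iSup_maxGenEigenspace_eq_top f]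
    refine le_antisymm (le_iSup f.maxGenEigenspace 0) (iSup_le fun μ ↦ ?_)
    rcases eq_or_ne μ 0 with rfl | hμ
    · exact le_rfl
    · suffices f.maxGenEigenspace μ = ⊥ by simp [this]
      by_contra h
      have : f.HasEigenvalue μ := by
        rw [Module.End.maxGenEigenspace_eq_genEigenspace_finrank] at h
        exact Module.End.hasEigenvalue_of_hasGenEigenvalue (k := Module.finrank K V) h
      exact this (hf μ hμ)
  rw [Module.End.maxGenEigenspace_eq_genEigenspace_finrank, Module.End.genEigenspace_nat,
    zero_smul, sub_zero, LinearMap.ker_eq_top] at htop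
  exact ⟨_, htop⟩

section

variable {K g : Type*} [Field K] [LieRing g] [LieAlgebra K g]

theorem LieAlgebra.trace_restrict_ad_eq_zero {S E : Submodule K g}
    (hE : ∀ a ∈ S, ∀ e ∈ E, ⁅a, e⁆ ∈ E) {w : g}
    (hw : w ∈ Submodule.span K {z : g | ∃ a ∈ S, ∃ b ∈ S, z = ⁅a, b⁆}) :
    ∃ h : ∀ e ∈ E, LieAlgebra.ad K g w e ∈ E,
      LinearMap.trace K E ((LieAlgebra.ad K g w).restrict h) = 0 := by
  induction hw using Submodule.span_induction with
  | mem w hw =>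
    obtain ⟨a, ha, b, hb, rfl⟩ := hw
    have ha' : ∀ e ∈ E, LieAlgebra.ad K g a e ∈ E := hE a ha
    have hb' : ∀ e ∈ E, LieAlgebra.ad K g b e ∈ E := hE b hb
    refine ⟨fun e he ↦ ?_, ?_⟩
    · rw [LieAlgebra.ad_apply, lie_lie]
      exact E.sub_mem (ha' _ (hb' _ he)) (hb' _ (ha' _ he))
    · have : (LieAlgebra.ad K g ⁅a, b⁆).restrict (p := E) (q := E) (fun e he ↦ by
          rw [LieAlgebra.ad_apply, lie_lie]
          exact E.sub_mem (ha' _ (hb' _ he)) (hb' _ (ha' _ he))) =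
          (LieAlgebra.ad K g a).restrict ha' * (LieAlgebra.ad K g b).restrict hb' -
          (LieAlgebra.ad K g b).restrict hb' * (LieAlgebra.ad K g a).restrict ha' := by
        ext e
        simp
      rw [this, map_sub, LinearMap.trace_mul_comm, sub_self]
  | zero =>
    refine ⟨by simp, ?_⟩
    convert map_zero (LinearMap.trace K E)
    ext; simp
  | add u v _ _ hu hv =>
    obtain ⟨hu, hu'⟩ := hu
    obtain ⟨hv, hv'⟩ := hv
    refine ⟨fun e he ↦ by simpa using E.add_mem (hu e he) (hv e he), ?_⟩
    have h := map_add (LinearMap.trace K E) ((LieAlgebra.ad K g u).restrict hu)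
      ((LieAlgebra.ad K g v).restrict hv)
    rw [hu', hv', add_zero] at h
    rw [← h]
    congr 1
    ext; simp
  | smul c u _ hu =>
    obtain ⟨hu, hu'⟩ := hu
    refine ⟨fun e he ↦ by simpa using E.smul_mem c (hu e he), ?_⟩
    have h := map_smul (LinearMap.trace K E) c ((LieAlgebra.ad K g u).restrict hu)
    rw [hu', smul_zero] at h
    rw [← h]
    congr 1
    ext; simp

variable [FiniteDimensional K g]

theorem LieAlgebra.isNilpotent_ad_of_mem_span_lie [CharZero K] [IsAlgClosed K] {S : Submodule K g}
    {z : g} (hz : z ∈ Submodule.span K {z : g | ∃ a ∈ S, ∃ b ∈ S, z = ⁅a, b⁆})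
    (hc : ∀ a ∈ S, ⁅z, a⁆ = 0) : IsNilpotent (LieAlgebra.ad K g z) := by
  refine Module.End.isNilpotent_of_eigenspace_eq_bot fun μ hμ ↦ ?_
  obtain ⟨h, htr⟩ := LieAlgebra.trace_restrict_ad_eq_zero (S := S)
    (E := (LieAlgebra.ad K g z).eigenspace μ) (fun a ha e he ↦ by
      rw [Module.End.mem_eigenspace_iff, LieAlgebra.ad_apply] at he ⊢
      rw [leibniz_lie, hc a ha, he, zero_lie, zero_add, lie_smul]) hz
  have : (LieAlgebra.ad K g z).restrict h = μ • LinearMap.id := by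
    ext e
    simpa using Module.End.mem_eigenspace_iff.mp e.2
  rw [this, map_smul, LinearMap.trace_id, smul_eq_mul, mul_eq_zero, or_iff_right hμ,
    Nat.cast_eq_zero] at htr
  exact Submodule.finrank_eq_zero.mp htr

theorem LieAlgebra.killingForm_eq_zero_of_mem_span_lie [CharZero K] [IsAlgClosed K]
    {S : Submodule K g} {z : g}
    (hz : z ∈ Submodule.span K {z : g | ∃ a ∈ S, ∃ b ∈ S, z = ⁅a, b⁆})
    (hc : ∀ a ∈ S, ⁅z, a⁆ = 0) {y : g} (hy : y ∈ S) : killingForm K g z y = 0 := by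
  have hcomm : Commute (LieAlgebra.ad K g z) (LieAlgebra.ad K g y) := by
    refine LinearMap.ext fun u ↦ ?_
    simpa [hc y hy] using leibniz_lie z y u
  have := hcomm.isNilpotent_mul_right (LieAlgebra.isNilpotent_ad_of_mem_span_lie hz hc)
  exact (LinearMap.isNilpotent_trace_of_isNilpotent this).eq_zero

theorem LieAlgebra.killingForm_apply_eq_zero_iff [CharZero K]
    (hred : LieAlgebra.radical K g ≤ LieAlgebra.center K g) {z : g} :
    (∀ y, killingForm K g z y = 0) ↔ ∀ y : g, ⁅y, z⁆ = 0 := by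
  constructor
  · intro h
    have : z ∈ LieAlgebra.center K g := hred <| LieAlgebra.killingCompl_top_le_radical K g <| by
      rw [LieIdeal.mem_killingCompl]
      intro y _
      rw [LieModule.traceForm_comm, h]
    exact (LieModule.mem_maxTrivSubmodule K g g z).mp this
  · intro h y
    have : LieAlgebra.ad K g z = 0 := by
      ext y
      rw [LieAlgebra.ad_apply, ← lie_skew, h, neg_zero, LinearMap.zero_apply]
    rw [killingForm_apply_apply, this, LinearMap.zero_comp, map_zero]

theorem LieAlgebra.exists_killingForm_lie_eq [CharZero K]
    (hred : LieAlgebra.radical K g ≤ LieAlgebra.center K g) (l : Module.Dual K g) :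
    ∃ w : g, ∀ x y : g, l ⁅x, y⁆ = killingForm K g w ⁅x, y⁆ := by
  have hκ : ∀ f : Module.Dual K g, (∀ z, (∀ y : g, ⁅y, z⁆ = 0) → f z = 0) →
      f ∈ LinearMap.range (killingForm K g) := by
    intro f hf
    have hr : (LinearMap.ker (killingForm K g)).dualAnnihilator =
        LinearMap.range (killingForm K g) :=
      LinearMap.dualAnnihilator_ker_eq_range_flip.trans
        (congr_arg LinearMap.range (LieModule.traceForm_flip K g g))
    rw [← hr, Submodule.mem_dualAnnihilator]
    intro z hz
    refine hf z ((LieAlgebra.killingForm_apply_eq_zero_iff hred).mp fun y ↦ ?_)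
    rw [LinearMap.mem_ker.mp hz, LinearMap.zero_apply]
  have hcen : ∀ {z : g}, (∀ y : g, ⁅y, z⁆ = 0) → LieAlgebra.ad K g z = 0 := by
    intro z hz
    ext y
    rw [LieAlgebra.ad_apply, ← lie_skew, hz, neg_zero, LinearMap.zero_apply]
  let c : g →ₗ[K] Module.Dual K g := (LieAlgebra.ad K g : g →ₗ[K] Module.End K g).compr₂ l
  have hc : ∀ x y, c x y = l ⁅x, y⁆ := fun x y ↦ rfl
  obtain ⟨D, hD⟩ := Module.projective_lifting_property (killingForm K g).rangeRestrict
    (c.codRestrict (LinearMap.range (killingForm K g)) fun x ↦ hκ _ fun z hz ↦ by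
      rw [hc, hz, map_zero]) (LinearMap.surjective_rangeRestrict _)
  replace hD : ∀ x y, killingForm K g (D x) y = l ⁅x, y⁆ := by
    intro x y
    have := congr_arg Subtype.val (LinearMap.congr_fun hD x)
    exact LinearMap.congr_fun this y
  obtain ⟨w, hw⟩ := hκ ((LinearMap.trace K g).comp ((LinearMap.mulLeft K D).comp
    (LieAlgebra.ad K g : g →ₗ[K] Module.End K g))) (by
      intro z hz
      simp [hcen hz])
  replace hw : ∀ y, killingForm K g w y = LinearMap.trace K g (D * LieAlgebra.ad K g y) := by
    intro y
    rw [hw]; rfl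
  -- `D` is a derivation modulo the centre
  have hder : ∀ x y u : g, ⁅u, D ⁅x, y⁆ - ⁅D x, y⁆ - ⁅x, D y⁆⁆ = 0 := by
    intro x y
    refine (LieAlgebra.killingForm_apply_eq_zero_iff hred).mp fun u ↦ ?_
    have h1 := hD ⁅x, y⁆ u
    have h2 := hD x ⁅y, u⁆
    have h3 := hD y ⁅x, u⁆
    rw [← LieModule.traceForm_apply_lie_apply] at h2
    have h4 := LieModule.traceForm_apply_lie_apply' K g g x (D y) u
    rw [map_sub, map_sub, LinearMap.sub_apply, LinearMap.sub_apply, h1, h2, h4, h3, lie_lie,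
      map_sub]
    ring
  have hE : ∀ x u : g, ⁅u, D x - ⁅w, x⁆⁆ = 0 := by
    intro x
    refine (LieAlgebra.killingForm_apply_eq_zero_iff hred).mp fun y ↦ ?_
    have hmul : LieAlgebra.ad K g y * LieAlgebra.ad K g (D x) =
        LieAlgebra.ad K g y * (D * LieAlgebra.ad K g x) -
          LieAlgebra.ad K g y * LieAlgebra.ad K g x * D := by
      ext v
      have := hder x v y
      rw [lie_sub, lie_sub, sub_right_comm, sub_eq_zero] at this
      simpa using this.symm
    have hbr : D * LieAlgebra.ad K g ⁅x, y⁆ =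
        D * LieAlgebra.ad K g x * LieAlgebra.ad K g y -
          D * (LieAlgebra.ad K g y * LieAlgebra.ad K g x) := by
      ext v
      simp
    have htr : killingForm K g (D x) y = killingForm K g w ⁅x, y⁆ := by
      rw [hw, hbr, LieModule.traceForm_comm]
      change LinearMap.trace K g (LieAlgebra.ad K g y * LieAlgebra.ad K g (D x)) = _
      rw [hmul, map_sub, map_sub, LinearMap.trace_mul_comm K (LieAlgebra.ad K g y),
        LinearMap.trace_mul_comm K _ D]
    rw [map_sub, LinearMap.sub_apply, htr, LieModule.traceForm_apply_lie_apply, sub_self]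
  refine ⟨w, fun x y ↦ ?_⟩
  have := (LieAlgebra.killingForm_apply_eq_zero_iff hred).mpr (hE x) y
  rw [map_sub, LinearMap.sub_apply, hD, LieModule.traceForm_apply_lie_apply, sub_eq_zero] at this
  exact this

theorem LieAlgebra.eq_zero_of_mem_span_lie_of_central [CharZero K]
    (hred : LieAlgebra.radical K g ≤ LieAlgebra.center K g) {z : g}
    (hz : z ∈ Submodule.span K {z : g | ∃ a b : g, z = ⁅a, b⁆})
    (hc : ∀ y : g, ⁅y, z⁆ = 0) : z = 0 := by
  rw [← Module.forall_dual_apply_eq_zero_iff K]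
  intro l
  obtain ⟨w, hw⟩ := LieAlgebra.exists_killingForm_lie_eq hred l
  have : Submodule.span K {z : g | ∃ a b : g, z = ⁅a, b⁆} ≤
      LinearMap.eqLocus l (killingForm K g w) := by
    rw [Submodule.span_le]
    rintro _ ⟨a, b, rfl⟩
    exact hw a b
  rw [show l z = killingForm K g w z from this hz, LieModule.traceForm_comm,
    (LieAlgebra.killingForm_apply_eq_zero_iff hred).mpr hc]

end

section

variable {K g : Type*} [Field K] [LieRing g] [LieAlgebra K g]

theorem LieAlgebra.span_lie_ker_ad_le (s : g) :
    Submodule.span K {z : g | ∃ a ∈ LinearMap.ker (LieAlgebra.ad K g s),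
      ∃ b ∈ LinearMap.ker (LieAlgebra.ad K g s), z = ⁅a, b⁆} ≤
      LinearMap.ker (LieAlgebra.ad K g s) := by
  rw [Submodule.span_le]
  rintro _ ⟨a, ha, b, hb, rfl⟩
  simp only [LinearMap.mem_ker, LieAlgebra.ad_apply, SetLike.mem_coe] at ha hb ⊢
  rw [leibniz_lie, ha, hb, zero_lie, lie_zero, add_zero]

theorem LieAlgebra.mem_center_ker_ad_iff {s z : g} :
    z ∈ LinearMap.ker (LieAlgebra.ad K g s) ⊓
      ⨅ y : LinearMap.ker (LieAlgebra.ad K g s), LinearMap.ker (LieAlgebra.ad K g (y : g)) ↔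
    z ∈ LinearMap.ker (LieAlgebra.ad K g s) ∧
      ∀ y ∈ LinearMap.ker (LieAlgebra.ad K g s), ⁅y, z⁆ = 0 := by
  rw [Submodule.mem_inf, Submodule.mem_iInf]
  exact and_congr_right fun _ ↦ Subtype.forall

variable [FiniteDimensional K g] [CharZero K]

theorem LieAlgebra.central_of_killingForm_eq_zero_on_ker_ad
    (hred : LieAlgebra.radical K g ≤ LieAlgebra.center K g) {s z : g}
    (hs : (LieAlgebra.ad K g s).IsSemisimple) (hz : z ∈ LinearMap.ker (LieAlgebra.ad K g s))
    (h : ∀ y ∈ LinearMap.ker (LieAlgebra.ad K g s), killingForm K g z y = 0) (y : g) :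
    ⁅y, z⁆ = 0 := by
  refine (LieAlgebra.killingForm_apply_eq_zero_iff hred).mp (fun y ↦ ?_) y
  obtain ⟨a, ha, _, ⟨b, rfl⟩, rfl⟩ := Submodule.mem_sup.mp
    (hs.isCompl_ker_range.sup_eq_top ▸ Submodule.mem_top :
      y ∈ LinearMap.ker (LieAlgebra.ad K g s) ⊔ LinearMap.range (LieAlgebra.ad K g s))
  have hz' : ⁅z, s⁆ = 0 := by
    rw [← lie_skew, show ⁅s, z⁆ = 0 from hz, neg_zero]
  rw [map_add, h a ha, zero_add, LieAlgebra.ad_apply, ← LieModule.traceForm_apply_lie_apply, hz',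
    map_zero, LinearMap.zero_apply]

theorem LieAlgebra.center_inf_span_lie_ker_ad [IsAlgClosed K]
    (hred : LieAlgebra.radical K g ≤ LieAlgebra.center K g) {s : g}
    (hs : (LieAlgebra.ad K g s).IsSemisimple) :
    (LinearMap.ker (LieAlgebra.ad K g s) ⊓
      ⨅ y : LinearMap.ker (LieAlgebra.ad K g s), LinearMap.ker (LieAlgebra.ad K g (y : g))) ⊓
      Submodule.span K {z : g | ∃ a ∈ LinearMap.ker (LieAlgebra.ad K g s),
        ∃ b ∈ LinearMap.ker (LieAlgebra.ad K g s), z = ⁅a, b⁆} = ⊥ := by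
  rw [eq_bot_iff]
  rintro z ⟨hz, hzd⟩
  obtain ⟨hzs, hzc⟩ := LieAlgebra.mem_center_ker_ad_iff.mp hz
  refine LieAlgebra.eq_zero_of_mem_span_lie_of_central (K := K) hred
    (Submodule.span_mono ?_ hzd)
    (LieAlgebra.central_of_killingForm_eq_zero_on_ker_ad hred hs hzs fun y hy ↦
      LieAlgebra.killingForm_eq_zero_of_mem_span_lie hzd (fun a ha ↦ ?_) hy)
  · rintro _ ⟨a, _, b, _, rfl⟩
    exact ⟨a, b, rfl⟩
  · rw [← lie_skew, hzc a ha, neg_zero]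

theorem LieAlgebra.center_sup_span_lie_ker_ad [IsAlgClosed K]
    (hred : LieAlgebra.radical K g ≤ LieAlgebra.center K g) {s : g}
    (hs : (LieAlgebra.ad K g s).IsSemisimple) :
    (LinearMap.ker (LieAlgebra.ad K g s) ⊓
      ⨅ y : LinearMap.ker (LieAlgebra.ad K g s), LinearMap.ker (LieAlgebra.ad K g (y : g))) ⊔
      Submodule.span K {z : g | ∃ a ∈ LinearMap.ker (LieAlgebra.ad K g s),
        ∃ b ∈ LinearMap.ker (LieAlgebra.ad K g s), z = ⁅a, b⁆} =
      LinearMap.ker (LieAlgebra.ad K g s) := by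
  have hinf := LieAlgebra.center_inf_span_lie_ker_ad hred hs
  have hle := LieAlgebra.span_lie_ker_ad_le (K := K) s
  have hcen (z : g) := LieAlgebra.mem_center_ker_ad_iff (K := K) (s := s) (z := z)
  have hmem : ∀ a ∈ LinearMap.ker (LieAlgebra.ad K g s),
      ∀ b ∈ LinearMap.ker (LieAlgebra.ad K g s),
      ⁅a, b⁆ ∈ Submodule.span K {z : g | ∃ a ∈ LinearMap.ker (LieAlgebra.ad K g s),
        ∃ b ∈ LinearMap.ker (LieAlgebra.ad K g s), z = ⁅a, b⁆} :=
    fun a ha b hb ↦ Submodule.subset_span ⟨a, ha, b, hb, rfl⟩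
  set C := LinearMap.ker (LieAlgebra.ad K g s)
  set Z := C ⊓ ⨅ y : C, LinearMap.ker (LieAlgebra.ad K g (y : g))
  set D := Submodule.span K {z : g | ∃ a ∈ C, ∃ b ∈ C, z = ⁅a, b⁆}
  have hZC : Z ≤ C := inf_le_left
  refine Submodule.eq_of_le_of_finrank_le (sup_le hZC hle) ?_
  let f : C →ₗ[K] Module.Dual K D := (killingForm K g).domRestrict₁₂ C D
  have hf : (LinearMap.ker f).map C.subtype ≤ Z := by
    rintro _ ⟨w, hw, rfl⟩
    refine (hcen w).mpr ⟨w.2, fun y hy ↦ ?_⟩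
    refine LieAlgebra.eq_zero_of_mem_span_lie_of_central (K := K) hred
      (Submodule.subset_span ⟨_, _, rfl⟩) fun u ↦
        LieAlgebra.central_of_killingForm_eq_zero_on_ker_ad hred hs (hle (hmem y hy w w.2))
          (fun v hv ↦ ?_) u
    rw [LieModule.traceForm_apply_lie_apply', neg_eq_zero]
    exact LinearMap.congr_fun hw ⟨_, hmem y hy v hv⟩
  have h1 := LinearMap.finrank_range_add_finrank_ker f
  have h2 := Submodule.finrank_le (LinearMap.range f)
  rw [Subspace.dual_finrank_eq] at h2
  have h3 := Submodule.finrank_mono hf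
  rw [← (Submodule.equivMapOfInjective _ C.injective_subtype (LinearMap.ker f)).finrank_eq] at h3
  have h4 := Submodule.finrank_sup_add_finrank_inf_eq Z D
  rw [hinf, finrank_bot] at h4
  omega

end

theorem Module.End.sup_inf_eigenspace {K V : Type*} [Field K] [AddCommGroup V] [Module K V]
    {f : Module.End K V} {P Q : Submodule K V} (hP : ∀ v ∈ P, f v ∈ P) (hQ : ∀ v ∈ Q, f v ∈ Q)
    (hPQ : P ⊓ Q = ⊥) (μ : K) :
    (P ⊓ f.eigenspace μ) ⊔ (Q ⊓ f.eigenspace μ) = (P ⊔ Q) ⊓ f.eigenspace μ := by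
  refine le_antisymm (sup_le (inf_le_inf_right _ le_sup_left) (inf_le_inf_right _ le_sup_right)) ?_
  rintro _ ⟨hv, he⟩
  obtain ⟨p, hp, q, hq, rfl⟩ := Submodule.mem_sup.mp hv
  have hpq : f p - μ • p = -(f q - μ • q) := by
    have := Module.End.mem_eigenspace_iff.mp he
    rw [map_add, smul_add] at this
    rw [eq_neg_iff_add_eq_zero, sub_add_sub_comm, this, sub_self]
  have h0 : f p - μ • p = 0 := by
    rw [← Submodule.mem_bot K, ← hPQ]
    refine ⟨P.sub_mem (hP p hp) (P.smul_mem μ hp), ?_⟩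
    rw [hpq]
    exact Q.neg_mem (Q.sub_mem (hQ q hq) (Q.smul_mem μ hq))
  have h0' : f q - μ • q = 0 := by rwa [h0, eq_comm, neg_eq_zero] at hpq
  exact Submodule.add_mem_sup ⟨hp, Module.End.mem_eigenspace_iff.mpr (sub_eq_zero.mp h0)⟩
    ⟨hq, Module.End.mem_eigenspace_iff.mpr (sub_eq_zero.mp h0')⟩

section

variable {K g : Type*} [Field K] [LieRing g] [LieAlgebra K g] {θ : g →ₗ[K] g} {ζ : K} {s : g}

theorem LieAlgebra.map_lie_of_mem_eigenspace (hbr : ∀ a b : g, θ ⁅a, b⁆ = ⁅θ a, θ b⁆)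
    (hs : s ∈ Module.End.eigenspace θ ζ) (v : g) :
    θ (LieAlgebra.ad K g s v) = ζ • LieAlgebra.ad K g s (θ v) := by
  rw [LieAlgebra.ad_apply, hbr, Module.End.mem_eigenspace_iff.mp hs, smul_lie, LieAlgebra.ad_apply]

theorem LieAlgebra.map_mem_ker_ad (hbr : ∀ a b : g, θ ⁅a, b⁆ = ⁅θ a, θ b⁆) (hζ : ζ ≠ 0)
    (hs : s ∈ Module.End.eigenspace θ ζ) {v : g} (hv : v ∈ LinearMap.ker (LieAlgebra.ad K g s)) :
    θ v ∈ LinearMap.ker (LieAlgebra.ad K g s) := by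
  have := LieAlgebra.map_lie_of_mem_eigenspace hbr hs v
  rw [LinearMap.mem_ker.mp hv, map_zero, eq_comm, smul_eq_zero, or_iff_right hζ] at this
  exact this

theorem LieAlgebra.map_mem_range_ad (hbr : ∀ a b : g, θ ⁅a, b⁆ = ⁅θ a, θ b⁆)
    (hs : s ∈ Module.End.eigenspace θ ζ) {v : g}
    (hv : v ∈ LinearMap.range (LieAlgebra.ad K g s)) :
    θ v ∈ LinearMap.range (LieAlgebra.ad K g s) := by
  obtain ⟨v, rfl⟩ := hv
  rw [LieAlgebra.map_lie_of_mem_eigenspace hbr hs]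
  exact Submodule.smul_mem _ _ ⟨_, rfl⟩

theorem LieAlgebra.map_mem_center_ker_ad (hbr : ∀ a b : g, θ ⁅a, b⁆ = ⁅θ a, θ b⁆) (hζ : ζ ≠ 0)
    (hs : s ∈ Module.End.eigenspace θ ζ) {m : ℕ} (hm : 0 < m) (hθ : θ ^ m = 1) {v : g}
    (hv : v ∈ LinearMap.ker (LieAlgebra.ad K g s) ⊓
      ⨅ y : LinearMap.ker (LieAlgebra.ad K g s), LinearMap.ker (LieAlgebra.ad K g (y : g))) :
    θ v ∈ LinearMap.ker (LieAlgebra.ad K g s) ⊓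
      ⨅ y : LinearMap.ker (LieAlgebra.ad K g s), LinearMap.ker (LieAlgebra.ad K g (y : g)) := by
  rw [LieAlgebra.mem_center_ker_ad_iff] at hv ⊢
  refine ⟨LieAlgebra.map_mem_ker_ad hbr hζ hs hv.1, fun y hy ↦ ?_⟩
  have hpow : ∀ n : ℕ, (θ ^ n) y ∈ LinearMap.ker (LieAlgebra.ad K g s) := by
    intro n
    induction n with
    | zero => simpa using hy
    | succ n ih =>
      rw [pow_succ']
      exact LieAlgebra.map_mem_ker_ad hbr hζ hs ih
  have hy' : θ ((θ ^ (m - 1)) y) = y := by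
    rw [← Module.End.mul_apply, ← pow_succ', Nat.sub_add_cancel hm, hθ, Module.End.one_apply]
  rw [← hy', ← hbr, hv.2 _ (hpow _), map_zero]

theorem LieAlgebra.map_mem_span_lie_ker_ad (hbr : ∀ a b : g, θ ⁅a, b⁆ = ⁅θ a, θ b⁆) (hζ : ζ ≠ 0)
    (hs : s ∈ Module.End.eigenspace θ ζ) {v : g}
    (hv : v ∈ Submodule.span K {z : g | ∃ a ∈ LinearMap.ker (LieAlgebra.ad K g s),
      ∃ b ∈ LinearMap.ker (LieAlgebra.ad K g s), z = ⁅a, b⁆}) :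
    θ v ∈ Submodule.span K {z : g | ∃ a ∈ LinearMap.ker (LieAlgebra.ad K g s),
      ∃ b ∈ LinearMap.ker (LieAlgebra.ad K g s), z = ⁅a, b⁆} := by
  rw [← Submodule.mem_comap]
  refine Submodule.span_le.mpr ?_ hv
  rintro _ ⟨a, ha, b, hb, rfl⟩
  exact Submodule.subset_span ⟨_, LieAlgebra.map_mem_ker_ad hbr hζ hs ha, _,
    LieAlgebra.map_mem_ker_ad hbr hζ hs hb, hbr a b⟩

theorem LieAlgebra.map_ad_eigenspace_one [FiniteDimensional K g]
    (hbr : ∀ a b : g, θ ⁅a, b⁆ = ⁅θ a, θ b⁆) (hζ : ζ ≠ 0)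
    (hs : s ∈ Module.End.eigenspace θ ζ) (hss : (LieAlgebra.ad K g s).IsSemisimple) :
    Submodule.map (LieAlgebra.ad K g s) (Module.End.eigenspace θ 1) =
      LinearMap.range (LieAlgebra.ad K g s) ⊓ Module.End.eigenspace θ ζ := by
  have hcompl := hss.isCompl_ker_range
  refine le_antisymm ?_ ?_
  · rintro _ ⟨v, hv, rfl⟩
    refine ⟨⟨v, rfl⟩, ?_⟩
    rw [SetLike.mem_coe, Module.End.mem_eigenspace_iff,
      LieAlgebra.map_lie_of_mem_eigenspace hbr hs, Module.End.mem_eigenspace_iff.mp hv, one_smul]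
  · rintro _ ⟨⟨u, rfl⟩, hu⟩
    obtain ⟨a, ha, b, hb, rfl⟩ := Submodule.mem_sup.mp
      (hcompl.sup_eq_top ▸ Submodule.mem_top :
        u ∈ LinearMap.ker (LieAlgebra.ad K g s) ⊔ LinearMap.range (LieAlgebra.ad K g s))
    rw [map_add, LinearMap.mem_ker.mp ha, zero_add] at hu ⊢
    refine ⟨b, ?_, rfl⟩
    have hker : θ b - b ∈ LinearMap.ker (LieAlgebra.ad K g s) := by
      have := (LieAlgebra.map_lie_of_mem_eigenspace hbr hs b).symm.trans
        (Module.End.mem_eigenspace_iff.mp hu)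
      rw [LinearMap.mem_ker, map_sub, sub_eq_zero]
      exact smul_right_injective g hζ this
    have hran : θ b - b ∈ LinearMap.range (LieAlgebra.ad K g s) :=
      Submodule.sub_mem _ (LieAlgebra.map_mem_range_ad hbr hs hb) hb
    rw [SetLike.mem_coe, Module.End.mem_eigenspace_iff, one_smul, ← sub_eq_zero]
    exact Submodule.disjoint_def.mp hcompl.disjoint _ hker hran

end


/-- Let `g` be a reductive complex Lie algebra with finite-order automorphism `θ` giving the
eigenspace grading `g_k`, and let `x = x_s + x_n ∈ g_1` be a Jordan decomposition
(`x_s` semisimple, `x_n` nilpotent, `⁅x_s, x_n⁆ = 0`).  With `m = Z_g(x_s)`,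
`Z_{x,1} = Z(m) ∩ g_1` and `h_{x,1} = [m,m] ∩ g_1`, there is a direct sum decomposition
`g_1 = [g_0, x_s] ⊕ Z_{x,1} ⊕ h_{x,1}`, and `[g_0, x_s] ≅ g_0 / Z_{g_0}(x_s)` as vector
spaces.  Consequently, if moreover `Z_{g_0}(x_s) = Z(g)_0 ⊕ ([m,m] ∩ g_0)`, then
`dim g_1 - dim g_0 = dim h_{x,1} - dim ([m,m] ∩ g_0) + dim Z_{x,1} - dim Z(g)_0`. -/
theorem stmt9 {g : Type*} [LieRing g] [LieAlgebra ℂ g] [FiniteDimensional ℂ g]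
    (hred : LieAlgebra.radical ℂ g ≤ LieAlgebra.center ℂ g)
    (m : ℕ) (hm : 0 < m) (θ : g →ₗ[ℂ] g)
    (hbr : ∀ a b : g, θ ⁅a, b⁆ = ⁅θ a, θ b⁆)
    (hθ : θ ^ m = 1) (ζ : ℂ) (hζ : IsPrimitiveRoot ζ m)
    (x xs xn : g) (hx : x = xs + xn)
    (hss : (LieAlgebra.ad ℂ g xs).IsSemisimple)
    (hnil : IsNilpotent (LieAlgebra.ad ℂ g xn))
    (hcomm : ⁅xs, xn⁆ = 0)
    (hx1 : x ∈ Module.End.eigenspace θ ζ)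
    (hxs1 : xs ∈ Module.End.eigenspace θ ζ)
    (hxn1 : xn ∈ Module.End.eigenspace θ ζ) :
    -- notation:
    --   g0 = Module.End.eigenspace θ 1, g1 = Module.End.eigenspace θ ζ
    --   centralizer m of xs: LinearMap.ker (ad xs)
    --   Z(m) = ker (ad xs) ⊓ ⨅_{y ∈ m} ker (ad y)
    --   [m,m] = span of brackets of elements of m
    --   Z(g) = ⨅_y ker (ad y)
    -- (1) the direct sum decomposition of g_1:
    (Submodule.map (LieAlgebra.ad ℂ g xs) (Module.End.eigenspace θ 1) ⊔
        ((LinearMap.ker (LieAlgebra.ad ℂ g xs) ⊓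
            (⨅ y : LinearMap.ker (LieAlgebra.ad ℂ g xs), LinearMap.ker (LieAlgebra.ad ℂ g (y : g))) ⊓
            Module.End.eigenspace θ ζ) ⊔
          (Submodule.span ℂ {z : g | ∃ a ∈ LinearMap.ker (LieAlgebra.ad ℂ g xs),
              ∃ b ∈ LinearMap.ker (LieAlgebra.ad ℂ g xs), z = ⁅a, b⁆} ⊓
            Module.End.eigenspace θ ζ)) = Module.End.eigenspace θ ζ) ∧
    (Submodule.map (LieAlgebra.ad ℂ g xs) (Module.End.eigenspace θ 1) ⊓
        ((LinearMap.ker (LieAlgebra.ad ℂ g xs) ⊓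
            (⨅ y : LinearMap.ker (LieAlgebra.ad ℂ g xs), LinearMap.ker (LieAlgebra.ad ℂ g (y : g))) ⊓
            Module.End.eigenspace θ ζ) ⊔
          (Submodule.span ℂ {z : g | ∃ a ∈ LinearMap.ker (LieAlgebra.ad ℂ g xs),
              ∃ b ∈ LinearMap.ker (LieAlgebra.ad ℂ g xs), z = ⁅a, b⁆} ⊓
            Module.End.eigenspace θ ζ)) = ⊥) ∧
    ((LinearMap.ker (LieAlgebra.ad ℂ g xs) ⊓
        (⨅ y : LinearMap.ker (LieAlgebra.ad ℂ g xs), LinearMap.ker (LieAlgebra.ad ℂ g (y : g))) ⊓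
        Module.End.eigenspace θ ζ) ⊓
      (Submodule.span ℂ {z : g | ∃ a ∈ LinearMap.ker (LieAlgebra.ad ℂ g xs),
          ∃ b ∈ LinearMap.ker (LieAlgebra.ad ℂ g xs), z = ⁅a, b⁆} ⊓
        Module.End.eigenspace θ ζ) = ⊥) ∧
    -- (2) `[g_0, x_s] ≅ g_0 / Z_{g_0}(x_s)` as vector spaces:
    Nonempty
      ((Submodule.map (LieAlgebra.ad ℂ g xs) (Module.End.eigenspace θ 1)) ≃ₗ[ℂ]
        ((Module.End.eigenspace θ 1) ⧸
          Submodule.comap (Module.End.eigenspace θ 1).subtype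
            (LinearMap.ker (LieAlgebra.ad ℂ g xs)))) ∧
    -- (3) the dimension identity, under `Z_{g_0}(x_s) = Z(g)_0 ⊕ ([m,m] ∩ g_0)`:
    ((LinearMap.ker (LieAlgebra.ad ℂ g xs) ⊓ Module.End.eigenspace θ 1 =
        ((⨅ y : g, LinearMap.ker (LieAlgebra.ad ℂ g y)) ⊓ Module.End.eigenspace θ 1) ⊔
          (Submodule.span ℂ {z : g | ∃ a ∈ LinearMap.ker (LieAlgebra.ad ℂ g xs),
              ∃ b ∈ LinearMap.ker (LieAlgebra.ad ℂ g xs), z = ⁅a, b⁆} ⊓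
            Module.End.eigenspace θ 1) ∧
      ((⨅ y : g, LinearMap.ker (LieAlgebra.ad ℂ g y)) ⊓ Module.End.eigenspace θ 1) ⊓
          (Submodule.span ℂ {z : g | ∃ a ∈ LinearMap.ker (LieAlgebra.ad ℂ g xs),
              ∃ b ∈ LinearMap.ker (LieAlgebra.ad ℂ g xs), z = ⁅a, b⁆} ⊓
            Module.End.eigenspace θ 1) = ⊥) →
      (Module.finrank ℂ (Module.End.eigenspace θ ζ) : ℤ) -
          Module.finrank ℂ (Module.End.eigenspace θ 1) =
        (Module.finrank ℂ
            ↥(Submodule.span ℂ {z : g | ∃ a ∈ LinearMap.ker (LieAlgebra.ad ℂ g xs),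
                ∃ b ∈ LinearMap.ker (LieAlgebra.ad ℂ g xs), z = ⁅a, b⁆} ⊓
              Module.End.eigenspace θ ζ) : ℤ) -
          Module.finrank ℂ
            ↥(Submodule.span ℂ {z : g | ∃ a ∈ LinearMap.ker (LieAlgebra.ad ℂ g xs),
                ∃ b ∈ LinearMap.ker (LieAlgebra.ad ℂ g xs), z = ⁅a, b⁆} ⊓
              Module.End.eigenspace θ 1) +
          Module.finrank ℂ
            ↥(LinearMap.ker (LieAlgebra.ad ℂ g xs) ⊓
              (⨅ y : LinearMap.ker (LieAlgebra.ad ℂ g xs),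
                LinearMap.ker (LieAlgebra.ad ℂ g (y : g))) ⊓
              Module.End.eigenspace θ ζ) -
          Module.finrank ℂ
            ↥((⨅ y : g, LinearMap.ker (LieAlgebra.ad ℂ g y)) ⊓
              Module.End.eigenspace θ 1)) := by
  have hζ0 : ζ ≠ 0 := hζ.ne_zero hm.ne'
  have hcompl := hss.isCompl_ker_range
  have hmap := LieAlgebra.map_ad_eigenspace_one hbr hζ0 hxs1 hss
  have hinf := LieAlgebra.center_inf_span_lie_ker_ad hred hss
  have hker := (Module.End.sup_inf_eigenspace
    (fun _ ↦ LieAlgebra.map_mem_center_ker_ad hbr hζ0 hxs1 hm hθ)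
    (fun _ ↦ LieAlgebra.map_mem_span_lie_ker_ad hbr hζ0 hxs1) hinf ζ).trans
    (congr_arg (· ⊓ Module.End.eigenspace θ ζ) (LieAlgebra.center_sup_span_lie_ker_ad hred hss))
  have hfull := Module.End.sup_inf_eigenspace (f := θ)
    (fun _ ↦ LieAlgebra.map_mem_range_ad hbr hxs1)
    (fun _ ↦ LieAlgebra.map_mem_ker_ad hbr hζ0 hxs1) hcompl.symm.inf_eq_bot ζ
  rw [hcompl.symm.sup_eq_top, top_inf_eq, ← hmap] at hfull
  have h1 : Submodule.map (LieAlgebra.ad ℂ g xs) (Module.End.eigenspace θ 1) ⊓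
      (LinearMap.ker (LieAlgebra.ad ℂ g xs) ⊓ Module.End.eigenspace θ ζ) = ⊥ := by
    rw [hmap, ← le_bot_iff, ← hcompl.symm.inf_eq_bot]
    exact inf_le_inf inf_le_left inf_le_left
  have h2 := le_bot_iff.mp ((inf_le_inf (inf_le_left (b := Module.End.eigenspace θ ζ))
    (inf_le_left (b := Module.End.eigenspace θ ζ))).trans hinf.le)
  let f := (LieAlgebra.ad ℂ g xs).domRestrict (Module.End.eigenspace θ 1)
  have hfr : LinearMap.range f =
      Submodule.map (LieAlgebra.ad ℂ g xs) (Module.End.eigenspace θ 1) :=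
    LinearMap.range_domRestrict _ _
  have hfk : LinearMap.ker f = Submodule.comap (Module.End.eigenspace θ 1).subtype
      (LinearMap.ker (LieAlgebra.ad ℂ g xs)) := rfl
  refine ⟨by rw [hker, hfull], by rw [hker, h1], h2,
    ⟨(LinearEquiv.ofEq _ _ hfr).symm.trans (f.quotKerEquivRange.symm)⟩, ?_⟩
  rintro ⟨hsum, hdisj⟩
  have e1 := Submodule.finrank_sup_add_finrank_inf_eq
    (Submodule.map (LieAlgebra.ad ℂ g xs) (Module.End.eigenspace θ 1))
    (LinearMap.ker (LieAlgebra.ad ℂ g xs) ⊓ Module.End.eigenspace θ ζ)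
  rw [h1, hfull, finrank_bot, ← hker] at e1
  have e2 := Submodule.finrank_sup_add_finrank_inf_eq
    (LinearMap.ker (LieAlgebra.ad ℂ g xs) ⊓
      (⨅ y : LinearMap.ker (LieAlgebra.ad ℂ g xs), LinearMap.ker (LieAlgebra.ad ℂ g (y : g))) ⊓
      Module.End.eigenspace θ ζ)
    (Submodule.span ℂ {z : g | ∃ a ∈ LinearMap.ker (LieAlgebra.ad ℂ g xs),
      ∃ b ∈ LinearMap.ker (LieAlgebra.ad ℂ g xs), z = ⁅a, b⁆} ⊓ Module.End.eigenspace θ ζ)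
  rw [h2, finrank_bot] at e2
  have e3 := Submodule.finrank_sup_add_finrank_inf_eq
    ((⨅ y : g, LinearMap.ker (LieAlgebra.ad ℂ g y)) ⊓ Module.End.eigenspace θ 1)
    (Submodule.span ℂ {z : g | ∃ a ∈ LinearMap.ker (LieAlgebra.ad ℂ g xs),
      ∃ b ∈ LinearMap.ker (LieAlgebra.ad ℂ g xs), z = ⁅a, b⁆} ⊓ Module.End.eigenspace θ 1)
  rw [hdisj, finrank_bot, ← hsum] at e3
  have e4 := LinearMap.finrank_range_add_finrank_ker f
  rw [hfr, hfk, (Submodule.equivMapOfInjective _ (Submodule.injective_subtype _) _).finrank_eq,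
    Submodule.map_comap_subtype, inf_comm] at e4
  omega
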